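/- Let S^R be the maximally permissive supervisor for the attacked closed-loop system G^R that is safe with respect to the resilient specification Ha and nonblocking. If for every detection state x_d ∈ X_det the post-attack state (A, x_d) belongs to the state set of S^R, then S^R is resilient with respect to Σ_{c,v} and G_robust; in particular, from every detection state the behavior permitted by S^R avoids X_v ∪ X_US and reaches a marked state of Ha, i.e., S^R enforces a robust-recovery strategy leading the system to G_robust. -/

import Mathlib

/-!
Common formalization of supervisory control of DES under actuator-enablement
attacks, following the natural-language context.

* A plant is a DFA with partial transition function `f : X → E → Option X`
  and initial state `x0`; `runFrom` extends `f` to strings; `Lang f x0` is the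
  generated language.
* A strict subautomaton of an automaton is represented by its state set
  `Q : Set X`, with induced transition function `subStep f Q`.
* Attacked events are modelled by the alphabet `E ⊕ E`: `Sum.inl e` is the
  ordinary event `e`, `Sum.inr e` is the attacked copy `eᵃ` (meaningful for
  `e ∈ Scv`).
* The attacked plant `gaStep`, attacked supervisor `saStep` (state `none`
  playing the role of the fresh state `A`), and their synchronous composition
  `grStep` (the attacked closed-loop system `G^R = Sa ∥ Ga`) are defined below,
  together with detection states, robust-recovery, the resilient specification
  `Ha`, supervisors for `G^R`, and resilience.
-/

open Classical List

namespace RobustRec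

variable {X : Type*} {E : Type*}

/-- Extension of a partial transition function to strings. -/
def runFrom (f : X → E → Option X) : X → List E → Option X
  | x, [] => some x
  | x, e :: w => (f x e).bind fun y => runFrom f y w

/-- Language generated from state `x0`. -/
def Lang (f : X → E → Option X) (x0 : X) : Set (List E) :=
  {w | (runFrom f x0 w).isSome}

/-- Transition function of the strict (induced) subautomaton with state set `Q`:
a transition is defined iff it is defined in the big automaton and both its
endpoints lie in `Q`. -/
noncomputable def subStep (f : X → E → Option X) (Q : Set X) : X → E → Option X :=
  fun x e => (f x e).bind fun y => if x ∈ Q ∧ y ∈ Q then some y else none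

/-- Vulnerable states: those where some vulnerable controllable event is feasible. -/
def vulnStates (f : X → E → Option X) (Scv : Set E) : Set X :=
  {x | ∃ e ∈ Scv, (f x e).isSome}

/-- A supervisor for the plant `(f, x0)`, represented by its state set `XS`
(the induced strict subautomaton): it contains `x0`, is controllable w.r.t.
the uncontrollable events `Suc`, and is safe w.r.t. the unsafe states `XUS`. -/
structure IsSupervisor (f : X → E → Option X) (x0 : X) (Suc : Set E)
    (XUS : Set X) (XS : Set X) : Prop where
  init_mem : x0 ∈ XS
  controllable : ∀ x ∈ XS, ∀ e ∈ Suc, ∀ y, f x e = some y → y ∈ XS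
  safe : ∀ x ∈ XS, x ∉ XUS

/-- The attacked plant `Ga`: all transitions of `G`, plus, for every transition
on a vulnerable event `σ ∈ Scv`, a parallel transition on its attacked copy. -/
noncomputable def gaStep (f : X → E → Option X) (Scv : Set E) :
    X → E ⊕ E → Option X
  | x, Sum.inl e => f x e
  | x, Sum.inr e => if e ∈ Scv then f x e else none

/-- The attacked supervisor `Sa`: states are `some x` for states `x` of `S`
plus the fresh state `A = none` with a self-loop on every event; for every
state `x` of `S` and `σ ∈ Scv` with `f_S(x,σ)` undefined there is a transition
on `σᵃ` from `x` to `A`. -/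
noncomputable def saStep (f : X → E → Option X) (XS : Set X) (Scv : Set E) :
    Option X → E ⊕ E → Option (Option X)
  | none, _ => some none
  | some x, Sum.inl e => (subStep f XS x e).map some
  | some x, Sum.inr e =>
      if e ∈ Scv ∧ x ∈ XS ∧ subStep f XS x e = none then some none else none

/-- Synchronous composition of two automata over a common alphabet. -/
def prodStep {X1 X2 A : Type*} (f1 : X1 → A → Option X1) (f2 : X2 → A → Option X2) :
    X1 × X2 → A → Option (X1 × X2) :=
  fun p a => (f1 p.1 a).bind fun y1 => (f2 p.2 a).map fun y2 => (y1, y2)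

/-- The attacked closed-loop system `G^R = Sa ∥ Ga`. Its post-attack states are
those of the form `(none, x)`, i.e. `(A, x)`. -/
noncomputable def grStep (f : X → E → Option X) (XS : Set X) (Scv : Set E) :
    Option X × X → E ⊕ E → Option (Option X × X) :=
  prodStep (saStep f XS Scv) (gaStep f Scv)

/-- Initial state of `G^R`. -/
def grInit (x0 : X) : Option X × X := (some x0, x0)

/-- Embedding of strings over `Σ` into strings over `Σ ∪ Σᵃ_{c,v}`. -/
def embed : List E → List (E ⊕ E) := List.map Sum.inl

/-- The language `L(Sa/Ga)` of the attacked closed-loop system. -/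
noncomputable def GRLang (f : X → E → Option X) (x0 : X) (XS : Set X) (Scv : Set E) :
    Set (List (E ⊕ E)) :=
  Lang (grStep f XS Scv) (grInit x0)

/-- The detection language `L_det = {sσ ∈ L(G) | s ∈ L(S/G), σ ∈ Σ_{c,v},
sσᵃ ∈ L(Sa/Ga)}`. -/
noncomputable def detLang (f : X → E → Option X) (x0 : X) (XS : Set X) (Scv : Set E) :
    Set (List E) :=
  {w | ∃ s σ, w = s ++ [σ] ∧ σ ∈ Scv ∧ w ∈ Lang f x0 ∧
        s ∈ Lang (subStep f XS) x0 ∧ embed s ++ [Sum.inr σ] ∈ GRLang f x0 XS Scv}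

/-- The detection states `X_det = {f(x0, sσ) : sσ ∈ L_det}`. -/
noncomputable def detStates (f : X → E → Option X) (x0 : X) (XS : Set X) (Scv : Set E) :
    Set X :=
  {x | ∃ w ∈ detLang f x0 XS Scv, runFrom f x0 w = some x}

/-- `r` is a robust-recovery strategy from `x` relative to the candidate set `R`
of recoverable states, the robust region `XR` and the bad states
`Bad = X_v ∪ X_US`: (1) `r` leads into `XR`; (2) no prefix of `r` visits `Bad`;
(3) no prefix of `r` can uncontrollably reach `Bad`; (4) any one-step
uncontrollable deviation from `r` lands in `R`. -/
def IsRecoveryPath (f : X → E → Option X) (Suc : Set E) (XR Bad : Set X)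
    (R : Set X) (x : X) (r : List E) : Prop :=
  (∃ y ∈ XR, runFrom f x r = some y) ∧
  (∀ t, t <+: r → ∀ y, runFrom f x t = some y → y ∉ Bad) ∧
  (∀ t, t <+: r → ∀ u : List E, (∀ e ∈ u, e ∈ Suc) →
      ∀ y, runFrom f x (t ++ u) = some y → y ∉ Bad) ∧
  (∀ t, t <+: r → ∀ e ∈ Suc, ∀ y, runFrom f x (t ++ [e]) = some y →
      ¬ (t ++ [e]) <+: r → y ∈ R)

/-- The set `R` of AE-robust recoverable states: the largest subset of
`X \ Bad` each of whose elements admits a robust-recovery strategy (relative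
to the set itself). -/
def recSet (f : X → E → Option X) (Suc : Set E) (XR Bad : Set X) : Set X :=
  ⋃₀ {R | R ⊆ Badᶜ ∧ ∀ x ∈ R, ∃ r, IsRecoveryPath f Suc XR Bad R x r}

/-- The attacked system `Sa/Ga` is AE-robust recoverable w.r.t. the robust
region `XR` if every detection state is AE-robust recoverable. -/
noncomputable def AERobustRecoverable (f : X → E → Option X) (x0 : X)
    (Suc Scv : Set E) (XUS XS XR : Set X) : Prop :=
  detStates f x0 XS Scv ⊆ recSet f Suc XR (vulnStates f Scv ∪ XUS)

/-- Reachable states of `G^R` (the state set of the synchronous composition). -/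
noncomputable def grStates (f : X → E → Option X) (x0 : X) (XS : Set X) (Scv : Set E) :
    Set (Option X × X) :=
  {p | ∃ w, runFrom (grStep f XS Scv) (grInit x0) w = some p}

/-- A supervisor for `G^R`, represented by its state set `Q` (inducing a strict
subautomaton of `G^R`): it contains the initial state and is controllable
w.r.t. `Suc` (attacked events being controllable). -/
structure IsGRSupervisor (f : X → E → Option X) (x0 : X) (Suc Scv : Set E)
    (XS : Set X) (Q : Set (Option X × X)) : Prop where
  subset : Q ⊆ grStates f x0 XS Scv
  init_mem : grInit x0 ∈ Q
  controllable : ∀ p ∈ Q, ∀ e ∈ Suc, ∀ q, grStep f XS Scv p (Sum.inl e) = some q → q ∈ Q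

/-- State set of the resilient specification `Ha`: `G^R` minus every post-attack
state `(A, x)` with `x ∈ X_v ∪ X_US`. -/
def haCarrier (f : X → E → Option X) (Scv : Set E) (XUS : Set X) :
    Set (Option X × X) :=
  {p | ¬ (p.1 = none ∧ p.2 ∈ vulnStates f Scv ∪ XUS)}

/-- Marked states of `Ha`: post-attack states `(A, x)` with `x` in the robust
region. -/
def haMarked (XR : Set X) : Set (Option X × X) :=
  {p | p.1 = (none : Option X) ∧ p.2 ∈ XR}

/-- The closed-loop language `L(S^R/G^R) = L(S^R)` of a supervisor `Q` for `G^R`. -/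
noncomputable def SRLang (f : X → E → Option X) (x0 : X) (XS : Set X) (Scv : Set E)
    (Q : Set (Option X × X)) : Set (List (E ⊕ E)) :=
  Lang (subStep (grStep f XS Scv) Q) (grInit x0)

/-- `S^R` is safe w.r.t. the resilient specification `Ha`: `L(S^R) ⊆ L(Ha)`. -/
noncomputable def SafeWrtHa (f : X → E → Option X) (x0 : X) (XS : Set X)
    (Scv : Set E) (XUS : Set X) (Q : Set (Option X × X)) : Prop :=
  SRLang f x0 XS Scv Q ⊆
    Lang (subStep (grStep f XS Scv) (haCarrier f Scv XUS)) (grInit x0)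

/-- `S^R` is nonblocking: from every post-attack state of `S^R`, a marked state
of `Ha` is reachable within `S^R`. -/
noncomputable def NonblockingSR (f : X → E → Option X) (XS : Set X) (Scv : Set E)
    (XR : Set X) (Q : Set (Option X × X)) : Prop :=
  ∀ p ∈ Q, p.1 = (none : Option X) →
    ∃ w q, runFrom (subStep (grStep f XS Scv) Q) p w = some q ∧ q ∈ haMarked XR

/-- `S^R` is maximally permissive among safe nonblocking supervisors for `G^R`. -/
noncomputable def MaxPermissive (f : X → E → Option X) (x0 : X) (Suc Scv : Set E)
    (XS XUS XR : Set X) (Q : Set (Option X × X)) : Prop :=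
  ∀ Q', IsGRSupervisor f x0 Suc Scv XS Q' → SafeWrtHa f x0 XS Scv XUS Q' →
    NonblockingSR f XS Scv XR Q' → SRLang f x0 XS Scv Q' ⊆ SRLang f x0 XS Scv Q

/-- `S^R` (given by its state set `Q`) is resilient w.r.t. `Scv` and the robust
region `XR`: it permits the full nominal behavior `L(S/G)`, and after any
AE-attack `sσᵃ` feasible in `L(Sa/Ga)` it permits the attack, keeps all its
subsequent behavior out of `Bad = X_v ∪ X_US`, and can always be extended
within `L(S^R)` to reach a post-attack state `(A, x)` with `x ∈ XR`; i.e. it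
enforces a robust-recovery strategy from the detection state. -/
noncomputable def ResilientSup (f : X → E → Option X) (x0 : X) (Scv : Set E)
    (XS XR Bad : Set X) (Q : Set (Option X × X)) : Prop :=
  (∀ s ∈ Lang (subStep f XS) x0, embed s ∈ SRLang f x0 XS Scv Q) ∧
  ∀ s : List E, embed s ∈ SRLang f x0 XS Scv Q →
    ∀ σ ∈ Scv, embed s ++ [Sum.inr σ] ∈ GRLang f x0 XS Scv →
      embed s ++ [Sum.inr σ] ∈ SRLang f x0 XS Scv Q ∧
      ∀ t : List E, embed s ++ [Sum.inr σ] ++ embed t ∈ SRLang f x0 XS Scv Q →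
        (∀ t', t' <+: t → ∀ y, runFrom f x0 (s ++ σ :: t') = some y →
            y ∉ Bad) ∧
        ∃ u q, runFrom (subStep (grStep f XS Scv) Q) (grInit x0)
                 (embed s ++ [Sum.inr σ] ++ embed t ++ u) = some q ∧
               q.1 = (none : Option X) ∧ q.2 ∈ XR

/-- A prefix-closed language. -/
def PrefixClosed (K : Set (List E)) : Prop := ∀ s t : List E, s ++ t ∈ K → s ∈ K

/-- `K` is controllable w.r.t. the language `M` and uncontrollable events `Suc`. -/
def ControllableLang (K M : Set (List E)) (Suc : Set E) : Prop :=
  ∀ s ∈ K, ∀ e ∈ Suc, s ++ [e] ∈ M → s ++ [e] ∈ K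

/-- The supremal controllable (prefix-closed) sublanguage of `M` w.r.t. `LG`. -/
def supC (M LG : Set (List E)) (Suc : Set E) : Set (List E) :=
  ⋃₀ {K | K ⊆ M ∧ PrefixClosed K ∧ ControllableLang K LG Suc}

end RobustRec

namespace RobustRec

theorem runFrom_append {X E : Type*} (f : X → E → Option X) (x : X) (u v : List E) :
    runFrom f x (u ++ v) = (runFrom f x u).bind fun y => runFrom f y v := by
  induction u generalizing x with
  | nil => simp [runFrom]
  | cons e u ih =>
    simp only [List.cons_append, runFrom]
    cases f x e with
    | none => rfl
    | some y => simpa using ih y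

theorem runFrom_append_some {X E : Type*} {f : X → E → Option X} {x z : X} {u v : List E} :
    runFrom f x (u ++ v) = some z ↔ ∃ y, runFrom f x u = some y ∧ runFrom f y v = some z := by
  rw [runFrom_append, Option.bind_eq_some_iff]

theorem runFrom_cons_some {X E : Type*} {f : X → E → Option X} {x z : X} {e : E} {v : List E} :
    runFrom f x (e :: v) = some z ↔ ∃ y, f x e = some y ∧ runFrom f y v = some z := by
  simp only [runFrom, Option.bind_eq_some_iff]

theorem runFrom_one {X E : Type*} {f : X → E → Option X} {x : X} {e : E} :
    runFrom f x [e] = f x e := by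
  simp [runFrom]

theorem subStep_some {X E : Type*} {f : X → E → Option X} {Q : Set X} {x y : X} {e : E} :
    subStep f Q x e = some y ↔ f x e = some y ∧ x ∈ Q ∧ y ∈ Q := by
  simp only [subStep, Option.bind_eq_some_iff]
  constructor
  · rintro ⟨a, ha, h⟩
    split_ifs at h with hc
    cases h
    exact ⟨ha, hc⟩
  · rintro ⟨h, hc⟩
    exact ⟨y, h, by simp [hc]⟩

theorem run_sub {X E : Type*} {f : X → E → Option X} {Q : Set X} {w : List E} {x y : X}
    (h : runFrom (subStep f Q) x w = some y) :
    runFrom f x w = some y ∧ (x ∈ Q → y ∈ Q) ∧ (w ≠ [] → y ∈ Q) := by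
  induction w generalizing x with
  | nil => simp only [runFrom, Option.some.injEq] at h; subst h; simp [runFrom]
  | cons e w ih =>
    obtain ⟨z, hz, hw⟩ := runFrom_cons_some.1 h
    obtain ⟨h1, h2, h3⟩ := subStep_some.1 hz
    obtain ⟨i1, i2, i3⟩ := ih hw
    exact ⟨runFrom_cons_some.2 ⟨z, h1, i1⟩, fun _ => i2 h3, fun _ => i2 h3⟩

theorem run_mono {X E : Type*} {f : X → E → Option X} {Q Q' : Set X} (hs : Q ⊆ Q')
    {w : List E} {x y : X} (h : runFrom (subStep f Q) x w = some y) :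
    runFrom (subStep f Q') x w = some y := by
  induction w generalizing x with
  | nil => exact h
  | cons e w ih =>
    obtain ⟨z, hz, hw⟩ := runFrom_cons_some.1 h
    obtain ⟨h1, h2, h3⟩ := subStep_some.1 hz
    exact runFrom_cons_some.2 ⟨z, subStep_some.2 ⟨h1, hs h2, hs h3⟩, ih hw⟩

/-- States reachable within the strict subautomaton with state set `Q`. -/
def ReachIn {X E : Type*} (f : X → E → Option X) (Q : Set X) (x0 : X) : Set X :=
  {p | ∃ w, runFrom (subStep f Q) x0 w = some p}

theorem run_reach {X E : Type*} {f : X → E → Option X} {Q : Set X} {x0 : X}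
    {w : List E} {x y : X} (hx : x ∈ ReachIn f Q x0)
    (h : runFrom (subStep f Q) x w = some y) :
    runFrom (subStep f (ReachIn f Q x0)) x w = some y ∧ y ∈ ReachIn f Q x0 := by
  induction w generalizing x with
  | nil => simp only [runFrom, Option.some.injEq] at h; subst h; exact ⟨rfl, hx⟩
  | cons e w ih =>
    obtain ⟨z, hz, hw⟩ := runFrom_cons_some.1 h
    have hzr : z ∈ ReachIn f Q x0 := by
      obtain ⟨v, hv⟩ := hx
      exact ⟨v ++ [e], runFrom_append_some.2 ⟨x, hv, by rw [runFrom_one]; exact hz⟩⟩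
    obtain ⟨i1, i2⟩ := ih hzr hw
    exact ⟨runFrom_cons_some.2
      ⟨z, subStep_some.2 ⟨(subStep_some.1 hz).1, hx, hzr⟩, i1⟩, i2⟩

theorem gr_inl {X E : Type*} {f : X → E → Option X} {XS : Set X} {Scv : Set E} {x : X} {e : E}
    {q : Option X × X} :
    grStep f XS Scv (some x, x) (Sum.inl e) = some q ↔
      ∃ y, subStep f XS x e = some y ∧ q = (some y, y) := by
  simp only [grStep, prodStep, saStep, gaStep, Option.bind_eq_some_iff, Option.map_eq_some_iff]
  constructor
  · rintro ⟨a, ⟨y, hy, rfl⟩, z, hz, rfl⟩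
    have := (subStep_some.1 hy).1
    rw [hz] at this
    cases this
    exact ⟨_, hy, rfl⟩
  · rintro ⟨y, hy, rfl⟩
    exact ⟨some y, ⟨y, hy, rfl⟩, y, (subStep_some.1 hy).1, rfl⟩

theorem gr_inr {X E : Type*} {f : X → E → Option X} {XS : Set X} {Scv : Set E} {x : X} {e : E}
    {q : Option X × X} (h : grStep f XS Scv (some x, x) (Sum.inr e) = some q) :
    ∃ y, f x e = some y ∧ q = (none, y) := by
  simp only [grStep, prodStep, saStep, gaStep, Option.bind_eq_some_iff,
    Option.map_eq_some_iff] at h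
  obtain ⟨a, ha, z, hz, rfl⟩ := h
  split_ifs at ha hz
  cases ha
  exact ⟨z, hz, rfl⟩

theorem gr_none {X E : Type*} {f : X → E → Option X} {XS : Set X} {Scv : Set E} {x : X}
    {a : E ⊕ E} {q : Option X × X} (h : grStep f XS Scv (none, x) a = some q) :
    q.1 = none ∧ gaStep f Scv x a = some q.2 := by
  simp only [grStep, prodStep, saStep, Option.bind_eq_some_iff, Option.map_eq_some_iff] at h
  obtain ⟨a, ha, z, hz, rfl⟩ := h
  cases ha
  exact ⟨rfl, hz⟩

theorem gr_run_none {X E : Type*} {f : X → E → Option X} {XS : Set X} {Scv : Set E} {x : X}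
    {w : List (E ⊕ E)} {q : Option X × X}
    (h : runFrom (grStep f XS Scv) (none, x) w = some q) : q.1 = none := by
  induction w generalizing x with
  | nil => simp only [runFrom, Option.some.injEq] at h; subst h; rfl
  | cons e w ih =>
    obtain ⟨⟨z1, z2⟩, hz, hw⟩ := runFrom_cons_some.1 h
    obtain ⟨h1, h2⟩ := gr_none hz
    cases h1
    exact ih hw

theorem gr_run_none_embed {X E : Type*} {f : X → E → Option X} {XS : Set X} {Scv : Set E}
    {x : X} {t : List E} {q : Option X × X}
    (h : runFrom (grStep f XS Scv) (none, x) (embed t) = some q) :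
    runFrom f x t = some q.2 := by
  induction t generalizing x with
  | nil => simp only [embed, List.map, runFrom, Option.some.injEq] at h; subst h; rfl
  | cons e w ih =>
    obtain ⟨⟨z1, z2⟩, hz, hw⟩ := runFrom_cons_some.1 h
    obtain ⟨h1, h2⟩ := gr_none hz
    cases h1
    exact runFrom_cons_some.2 ⟨z2, h2, ih hw⟩

theorem gr_run_embed {X E : Type*} {f : X → E → Option X} {XS : Set X} {Scv : Set E}
    {x : X} {t : List E} {q : Option X × X} :
    runFrom (grStep f XS Scv) (some x, x) (embed t) = some q ↔
      ∃ y, runFrom (subStep f XS) x t = some y ∧ q = (some y, y) := by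
  induction t generalizing x with
  | nil => simp [embed, runFrom, eq_comm]
  | cons e w ih =>
    simp only [embed, List.map_cons] at ih ⊢
    rw [runFrom_cons_some]
    constructor
    · rintro ⟨z, hz, hw⟩
      obtain ⟨y, hy, rfl⟩ := gr_inl.1 hz
      obtain ⟨y', hy', rfl⟩ := ih.1 hw
      exact ⟨y', runFrom_cons_some.2 ⟨y, hy, hy'⟩, rfl⟩
    · rintro ⟨y, hy, rfl⟩
      obtain ⟨z, hz, hw⟩ := runFrom_cons_some.1 hy
      exact ⟨(some z, z), gr_inl.2 ⟨z, hz, rfl⟩, ih.2 ⟨y, hw, rfl⟩⟩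

theorem lang_iff {X E : Type*} {f : X → E → Option X} {x : X} {w : List E} :
    w ∈ Lang f x ↔ ∃ y, runFrom f x w = some y := by
  simp [Lang, Option.isSome_iff_exists]

theorem reach_safe {X E : Type*} {f : X → E → Option X} {x0 : X} {Scv : Set E} {XUS XS : Set X}
    {Q : Set (Option X × X)} (hsafe : SafeWrtHa f x0 XS Scv XUS Q) :
    ReachIn (grStep f XS Scv) Q (grInit x0) ⊆ haCarrier f Scv XUS := by
  rintro p ⟨w, hw⟩
  obtain ⟨p', hp'⟩ := lang_iff.1 (hsafe (lang_iff.2 ⟨p, hw⟩))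
  have h1 := (run_sub hw).1
  have h2 := run_sub hp'
  rw [h2.1] at h1
  cases h1
  exact h2.2.1 (by simp [haCarrier, grInit])

theorem nominal_sub {X E : Type*}
    {f : X → E → Option X} {x0 : X} {Suc Scv : Set E} {XUS XS XR : Set X}
    {Q : Set (Option X × X)}
    (hQ : IsGRSupervisor f x0 Suc Scv XS Q)
    (hsafe : SafeWrtHa f x0 XS Scv XUS Q)
    (hnb : NonblockingSR f XS Scv XR Q)
    (hmax : MaxPermissive f x0 Suc Scv XS XUS XR Q) :
    ∀ s ∈ Lang (subStep f XS) x0, embed s ∈ SRLang f x0 XS Scv Q := by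
  let P : Set (Option X × X) := {p | ∃ s x, runFrom (subStep f XS) x0 s = some x ∧ p = (some x, x)}
  let R := ReachIn (grStep f XS Scv) Q (grInit x0)
  have hRQ : R ⊆ Q := fun p ⟨w, hw⟩ => (run_sub hw).2.1 hQ.init_mem
  have hinit : grInit x0 ∈ P := ⟨[], x0, rfl, rfl⟩
  have key : SRLang f x0 XS Scv (P ∪ R) ⊆ SRLang f x0 XS Scv Q := by
    apply hmax
    · refine ⟨?_, Or.inl hinit, ?_⟩
      · rintro p (⟨s, x, hs, rfl⟩ | ⟨w, hw⟩)
        · exact ⟨embed s, gr_run_embed.2 ⟨x, hs, rfl⟩⟩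
        · exact ⟨w, (run_sub hw).1⟩
      · rintro p (⟨s, x, hs, rfl⟩ | hp) e he q hq
        · obtain ⟨y, hy, rfl⟩ := gr_inl.1 hq
          exact Or.inl ⟨s ++ [e], y,
            runFrom_append_some.2 ⟨x, hs, by rw [runFrom_one]; exact hy⟩, rfl⟩
        · have hqQ := hQ.controllable p (hRQ hp) e he q hq
          have : runFrom (subStep (grStep f XS Scv) Q) p [Sum.inl e] = some q := by
            rw [runFrom_one]; exact subStep_some.2 ⟨hq, hRQ hp, hqQ⟩
          exact Or.inr (run_reach hp this).2
    · intro w hw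
      obtain ⟨p, hp⟩ := lang_iff.1 hw
      refine lang_iff.2 ⟨p, run_mono ?_ hp⟩
      rintro p (⟨s, x, hs, rfl⟩ | hp)
      · simp [haCarrier]
      · exact reach_safe hsafe hp
    · rintro p (⟨s, x, hs, rfl⟩ | hp) hpn
      · cases hpn
      · obtain ⟨w, q, hw, hq⟩ := hnb p (hRQ hp) hpn
        exact ⟨w, q, run_mono Set.subset_union_right (run_reach hp hw).1, hq⟩
  intro s hs
  apply key
  obtain ⟨x, hx⟩ := lang_iff.1 hs
  have hP : ∀ (s : List E) (x y : X), (some x, x) ∈ P → runFrom (subStep f XS) x s = some y →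
      runFrom (subStep (grStep f XS Scv) (P ∪ R)) (some x, x) (embed s) = some (some y, y) := by
    intro s
    induction s with
    | nil => intro x y _ h; simp only [runFrom, Option.some.injEq] at h; subst h; rfl
    | cons e s ih =>
      intro x y hxP h
      obtain ⟨z, hz, hw⟩ := runFrom_cons_some.1 h
      have hzP : (some z, z) ∈ P := by
        obtain ⟨v, x', hv, hxx⟩ := hxP
        cases hxx
        exact ⟨v ++ [e], z, runFrom_append_some.2 ⟨x, hv, by rw [runFrom_one]; exact hz⟩, rfl⟩
      exact runFrom_cons_some.2 ⟨(some z, z),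
        subStep_some.2 ⟨gr_inl.2 ⟨z, hz, rfl⟩, Or.inl hxP, Or.inl hzP⟩, ih z y hzP hw⟩
  exact lang_iff.2 ⟨_, hP s x0 x hinit hx⟩

/-- One attack step from a nominal string lands, within `Q`, in a post-attack state. -/
theorem attack_step {X E : Type*}
    {f : X → E → Option X} {x0 : X} {Scv : Set E} {XS : Set X}
    {Q : Set (Option X × X)} (hinit : grInit x0 ∈ Q)
    (hdet : ∀ x ∈ detStates f x0 XS Scv, ((none : Option X), x) ∈ Q)
    {s : List E} {σ : E} (hσ : σ ∈ Scv)
    (hs : embed s ∈ SRLang f x0 XS Scv Q)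
    (ha : embed s ++ [Sum.inr σ] ∈ GRLang f x0 XS Scv) :
    ∃ y, runFrom f x0 (s ++ [σ]) = some y ∧
      runFrom (subStep (grStep f XS Scv) Q) (grInit x0) (embed s ++ [Sum.inr σ])
        = some (none, y) := by
  obtain ⟨p, hp⟩ := lang_iff.1 hs
  obtain ⟨q, hq⟩ := lang_iff.1 ha
  obtain ⟨p', hp', hst⟩ := runFrom_append_some.1 hq
  obtain ⟨h1, h2, -⟩ := run_sub hp
  rw [h1] at hp'
  cases hp'
  obtain ⟨x, hx, rfl⟩ := gr_run_embed.1 h1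
  rw [runFrom_one] at hst
  obtain ⟨y, hy, rfl⟩ := gr_inr hst
  have hrun : runFrom f x0 (s ++ [σ]) = some y :=
    runFrom_append_some.2 ⟨x, (run_sub hx).1, by rw [runFrom_one]; exact hy⟩
  have hyQ : ((none : Option X), y) ∈ Q :=
    hdet y ⟨s ++ [σ], ⟨s, σ, rfl, hσ, lang_iff.2 ⟨y, hrun⟩, lang_iff.2 ⟨x, hx⟩, ha⟩, hrun⟩
  exact ⟨y, hrun, runFrom_append_some.2 ⟨_, hp, by
    rw [runFrom_one]; exact subStep_some.2 ⟨hst, h2 hinit, hyQ⟩⟩⟩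

end RobustRec

/-- the "if" direction of Theorem 1. Let `S^R` (state set `Q`)
be the maximally permissive safe nonblocking supervisor for `G^R` w.r.t. `Ha`.
If every detection state `x_d` has its post-attack state `(A, x_d)` in the state
set of `S^R`, then `S^R` is resilient w.r.t. `Σ_{c,v}` and `G_robust`; in
particular, from every detection state the behavior permitted by `S^R` avoids
`X_v ∪ X_US` and reaches a marked state of `Ha`. -/
theorem RobustRec.resilient_of_detStates_mem
    {X E : Type*} [Fintype X] [Fintype E]
    (f : X → E → Option X) (x0 : X) (Sc Suc Scv : Set E) (XUS XS XR : Set X)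
    (hdisj : Sc ∩ Suc = ∅) (hcover : Sc ∪ Suc = Set.univ) (hScv : Scv ⊆ Sc)
    (hS : IsSupervisor f x0 Suc XUS XS)
    (hXR : XR ∩ (vulnStates f Scv ∪ XUS) = ∅)
    (Q : Set (Option X × X))
    (hQ : IsGRSupervisor f x0 Suc Scv XS Q)
    (hsafe : SafeWrtHa f x0 XS Scv XUS Q)
    (hnb : NonblockingSR f XS Scv XR Q)
    (hmax : MaxPermissive f x0 Suc Scv XS XUS XR Q)
    (hdet : ∀ x ∈ detStates f x0 XS Scv, ((none : Option X), x) ∈ Q) :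
    ResilientSup f x0 Scv XS XR (vulnStates f Scv ∪ XUS) Q ∧
      ∀ x ∈ detStates f x0 XS Scv,
        (∀ (w : List (E ⊕ E)) (q : Option X × X),
            runFrom (subStep (grStep f XS Scv) Q) ((none : Option X), x) w = some q →
              q.2 ∉ vulnStates f Scv ∪ XUS) ∧
        (∃ (w : List (E ⊕ E)) (q : Option X × X),
            runFrom (subStep (grStep f XS Scv) Q) ((none : Option X), x) w = some q ∧
              q ∈ haMarked XR) := by
  have hnom := nominal_sub hQ hsafe hnb hmax
  have hRQ : ReachIn (grStep f XS Scv) Q (grInit x0) ⊆ Q :=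
    fun p ⟨w, hw⟩ => (run_sub hw).2.1 hQ.init_mem
  refine ⟨⟨hnom, ?_⟩, ?_⟩
  · intro s hs σ hσ ha
    obtain ⟨y, hy, hyr⟩ := attack_step hQ.init_mem hdet hσ hs ha
    refine ⟨lang_iff.2 ⟨_, hyr⟩, ?_⟩
    intro t ht
    obtain ⟨p, hp⟩ := lang_iff.1 ht
    obtain ⟨p', hp', hpt⟩ := runFrom_append_some.1 hp
    rw [hyr] at hp'
    cases hp'
    have hyR : ((none : Option X), y) ∈ ReachIn (grStep f XS Scv) Q (grInit x0) := ⟨_, hyr⟩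
    constructor
    · rintro t' ⟨t'', rfl⟩ z hz
      have hsplit : embed (t' ++ t'') = embed t' ++ embed t'' := by simp [embed]
      rw [hsplit] at hpt
      obtain ⟨m, hm, -⟩ := runFrom_append_some.1 hpt
      have hg := (run_sub hm).1
      have h1 := gr_run_none hg
      have h2 := gr_run_none_embed hg
      have hsz : s ++ σ :: t' = (s ++ [σ]) ++ t' := by simp
      rw [hsz, runFrom_append, hy, Option.bind_some, h2] at hz
      cases hz
      exact fun hb => reach_safe hsafe (run_reach hyR hm).2 ⟨h1, hb⟩
    · obtain ⟨u, q, hu, hq⟩ := hnb p (hRQ ⟨_, hp⟩) (gr_run_none (run_sub hpt).1)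
      exact ⟨u, q, runFrom_append_some.2 ⟨p, hp, hu⟩, hq.1, hq.2⟩
  · rintro x hx
    refine ⟨?_, hnb _ (hdet x hx) rfl⟩
    obtain ⟨w, ⟨s, σ, rfl, hσ, -, hs, ha⟩, hw⟩ := hx
    obtain ⟨y, hy, hyr⟩ := attack_step hQ.init_mem hdet hσ (hnom s hs) ha
    rw [hw] at hy
    cases hy
    intro w q hq hb
    exact reach_safe hsafe (run_reach ⟨_, hyr⟩ hq).2 ⟨gr_run_none (run_sub hq).1, hb⟩
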